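/- Let μ be a singular cardinal with cf(μ) = ℵ₀, let λ = μ⁺, and let μ* be a cardinal with ℵ₂ ≤ μ* ≤ λ. Let ⟨λ_n : n < ω⟩ be a strictly increasing sequence of regular cardinals, each greater than ℵ₁, with supremum μ, and let ⟨f_α : α < λ⟩ be a sequence witnessing λ = tcf(∏_n λ_n, <_{J^bd_ω}) which is moreover μ*-free. Then there exists a stationary family 𝒜 ⊆ [λ]^{ℵ₀} that does not reflect in any uncountable set A ⊆ λ of cardinality < μ*. -/

import Mathlib

open Cardinal Set

namespace ReflSCH

/-- `[B]^{<ℵ₁}`: the family of subsets of `B` of cardinality `< ℵ₁`,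
i.e. the countable subsets of `B`. -/
def small (B : Set Ordinal.{0}) : Set (Set Ordinal.{0}) := {a | a ⊆ B ∧ a.Countable}

/-- `[B]^{ℵ₀}`: the countably infinite subsets of `B`. -/
def ctblInf (B : Set Ordinal.{0}) : Set (Set Ordinal.{0}) :=
  {a | a ⊆ B ∧ a.Countable ∧ a.Infinite}

/-- A family is closed if the union of every nonempty `⊆`-increasing chain of fewer
than `ℵ₁` (i.e. countably many) of its members belongs to it. -/
def ClosedFam (𝒜 : Set (Set Ordinal.{0})) : Prop :=
  ∀ D : Set (Set Ordinal.{0}), D ⊆ 𝒜 → D.Nonempty → IsChain (· ⊆ ·) D → D.Countable →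
    ⋃₀ D ∈ 𝒜

/-- A family is unbounded in `[B]^{<ℵ₁}` if every member of `[B]^{<ℵ₁}` is contained in
some member of the family. -/
def UnbFam (B : Set Ordinal.{0}) (𝒜 : Set (Set Ordinal.{0})) : Prop :=
  ∀ y ∈ small B, ∃ x ∈ 𝒜, y ⊆ x

/-- A club of `[B]^{<ℵ₁}`. -/
def ClubFam (B : Set Ordinal.{0}) (𝒜 : Set (Set Ordinal.{0})) : Prop :=
  𝒜 ⊆ small B ∧ ClosedFam 𝒜 ∧ UnbFam B 𝒜

/-- The family `𝒜` meets every club of `[B]^{<ℵ₁}`. -/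
def MeetsClubs (B : Set Ordinal.{0}) (𝒜 : Set (Set Ordinal.{0})) : Prop :=
  ∀ 𝒞 : Set (Set Ordinal.{0}), ClubFam B 𝒞 → (𝒜 ∩ 𝒞).Nonempty

/-- Stationarity in `[B]^{<ℵ₁}`. -/
def StatFam (B : Set Ordinal.{0}) (𝒜 : Set (Set Ordinal.{0})) : Prop :=
  𝒜 ⊆ small B ∧ MeetsClubs B 𝒜

/-- `𝒜` reflects in `B₂` iff `𝒜 ∩ [B₂]^{ℵ₀}` is stationary in `[B₂]^{<ℵ₁}`. -/
def Reflects (𝒜 : Set (Set Ordinal.{0})) (B₂ : Set Ordinal.{0}) : Prop :=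
  StatFam B₂ (𝒜 ∩ ctblInf B₂)

/-- `f <_{J^{bd}_ω} g`: `f n < g n` for all but finitely many `n`. -/
def ltBd (f g : ℕ → Ordinal.{0}) : Prop := ∃ m : ℕ, ∀ n ≥ m, f n < g n

/-- `⟨f_α : α < lam.ord⟩` witnesses `lam = tcf (∏_n lamseq n, <_{J^{bd}_ω})`:
each `f_α ∈ ∏_n lamseq n`, the sequence is `<_{J^{bd}_ω}`-increasing, and it is
cofinal in the product. -/
def TcfWitness (lam : Cardinal.{0}) (lamseq : ℕ → Cardinal.{0})
    (f : Ordinal.{0} → ℕ → Ordinal.{0}) : Prop :=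
  (∀ α < lam.ord, ∀ n : ℕ, f α n < (lamseq n).ord) ∧
  (∀ α < lam.ord, ∀ β < lam.ord, α < β → ltBd (f α) (f β)) ∧
  (∀ g : ℕ → Ordinal.{0}, (∀ n : ℕ, g n < (lamseq n).ord) → ∃ α < lam.ord, ltBd g (f α))

/-- The sequence `⟨f_i : i ∈ I⟩` is free. -/
def Free (I : Set Ordinal.{0}) (f : Ordinal.{0} → ℕ → Ordinal.{0}) : Prop :=
  ∃ nf : Ordinal.{0} → ℕ, ∀ i ∈ I, ∀ j ∈ I, i < j →
    ∀ n : ℕ, nf i ≤ n → nf j ≤ n → f i n < f j n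


theorem bound {ι : Type 1} (a : Ordinal.{0}) (h : #ι < Cardinal.lift.{1,0} a.cof)
    (g : ι → Ordinal.{0}) : ∃ b < a, ∀ i, g i < a → g i < b := by
  refine ⟨sSup ((· + 1) '' (range g ∩ Iio a)), ?_, ?_⟩
  · apply Ordinal.sSup_add_one_lt_of_lt_cof
    · rw [← Ordinal.lift_cof]
      exact ((Cardinal.mk_le_mk_of_subset inter_subset_left).trans mk_range_le).trans_lt h
    · intro i hi; exact hi.2
  · intro i hi
    have : BddAbove ((· + 1) '' (range g ∩ Iio a)) := by
      refine ⟨a, ?_⟩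
      rintro _ ⟨y, ⟨_, hy⟩, rfl⟩
      exact Order.add_one_le_of_lt hy
    exact (Order.lt_add_one_iff.2 le_rfl).trans_le (le_csSup this ⟨g i, ⟨⟨i, rfl⟩, hi⟩, rfl⟩)

theorem bound_reg {ι : Type 1} (κ : Cardinal.{0}) (hκ : κ.IsRegular)
    (h : #ι < Cardinal.lift.{1,0} κ)
    (g : ι → Ordinal.{0}) : ∃ b < κ.ord, ∀ i, g i < κ.ord → g i < b := by
  exact bound _ (by rwa [hκ.cof_ord]) g

theorem bound_ctbl (a : Ordinal.{0}) (h : ℵ₀ < a.cof) (N : Set Ordinal.{0}) (hN : N.Countable) :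
    ∃ b < a, ∀ y ∈ N, y < a → y < b := by
  have hc : #N < Cardinal.lift.{1,0} a.cof := by
    have : #N ≤ ℵ₀ := Cardinal.mk_le_aleph0_iff.2 hN
    refine this.trans_lt ?_
    rwa [← Cardinal.lift_aleph0.{1,0}, Cardinal.lift_lt]
  obtain ⟨b, hb, h2⟩ := bound (ι := N) a hc (fun y => y.1)
  exact ⟨b, hb, fun y hy => h2 ⟨y, hy⟩⟩

/-- closed point lemma -/
theorem closed_point (κ c : Cardinal.{0}) (hκ : κ.IsRegular) (hc : c.IsRegular) (hcκ : c < κ)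
    (z : Ordinal.{0} → Ordinal.{0}) (hz : ∀ y < κ.ord, z y < κ.ord) :
    ∃ ρ < κ.ord, ρ.cof = c ∧ ∀ y < ρ, z y < ρ := by
  have hlimκ := Cardinal.isSuccLimit_ord hκ.aleph0_le
  have hlimc := Cardinal.isSuccLimit_ord hc.aleph0_le
  -- `y i` closed
  have key : ∃ y : Ordinal.{0} → Ordinal.{0}, ∀ i < c.ord, y i < κ.ord ∧ 
      ∀ j < i, y j < y i ∧ ∀ w ≤ y j, z w < y i := by
    let F : (i : Ordinal.{0}) → ((j : Ordinal.{0}) → j < i → Ordinal.{0}) → Ordinal.{0} := fun i r =>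
      sInf {b | ∀ j (h : j < i), r j h < b ∧ ∀ w ≤ r j h, z w < b}
    let y : Ordinal.{0} → Ordinal.{0} := WellFounded.fix (r := (· < ·)) Ordinal.lt_wf F
    have hy : ∀ i, y i = sInf {b | ∀ j < i, y j < b ∧ ∀ w ≤ y j, z w < b} := by
      intro i
      exact WellFounded.fix_eq _ F i
    refine ⟨y, ?_⟩
    intro i
    induction i using WellFoundedLT.induction with
    | ind i ih =>
      intro hi
      have hcard : ∀ o < κ.ord, #(Iio o) < Cardinal.lift.{1,0} κ := by
        intro o ho
        rw [Cardinal.mk_Iio_ordinal, Cardinal.lift_lt]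
        exact Cardinal.lt_ord.1 ho
      have h1 : ∀ j < i, ∃ b < κ.ord, ∀ w ≤ y j, z w < b := by
        intro j hj
        have hyj := (ih j hj (hj.trans hi)).1
        have hyj' : y j + 1 < κ.ord := by
          rw [← Order.succ_eq_add_one]; exact hlimκ.succ_lt hyj
        obtain ⟨b, hb, h2⟩ := bound_reg κ hκ (hcard _ hyj') (fun w => z w.1)
        refine ⟨b, hb, fun w hw => h2 ⟨w, Order.lt_add_one_iff.2 hw⟩ (hz _ (hw.trans_lt hyj))⟩
      choose! B hB1 hB2 using h1
      have hcard2 := hcard i (hi.trans (Cardinal.ord_lt_ord.2 hcκ))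
      obtain ⟨b1, hb1, h2⟩ := bound_reg κ hκ hcard2 (fun w => B w.1)
      obtain ⟨b2, hb2, h3⟩ := bound_reg κ hκ hcard2 (fun w => y w.1)
      have hmem : max b1 b2 ∈ {b | ∀ j < i, y j < b ∧ ∀ w ≤ y j, z w < b} := by
        intro j hj
        refine ⟨lt_max_of_lt_right (h3 ⟨j, hj⟩ (ih j hj (hj.trans hi)).1), fun w hw => ?_⟩
        exact lt_max_of_lt_left ((hB2 j hj w hw).trans (h2 ⟨j, hj⟩ (hB1 j hj)))
      refine ⟨?_, ?_⟩
      · rw [hy]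
        exact (csInf_le' hmem).trans_lt (max_lt hb1 hb2)
      · rw [hy]
        exact csInf_mem (s := {b | ∀ j < i, y j < b ∧ ∀ w ≤ y j, z w < b}) ⟨_, hmem⟩
  obtain ⟨y, hy⟩ := key
  have hsm : StrictMono (fun i : Iio c.ord => y i.1) := fun i j hij => ((hy j.1 j.2).2 i.1 hij).1
  refine ⟨⨆ i : Iio c.ord, y i, ?_, ?_, ?_⟩
  · have hcard : #(Iio c.ord) < Cardinal.lift.{1,0} κ := by
      rw [Cardinal.mk_Iio_ordinal, Cardinal.lift_lt]
      simpa using hcκ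
    obtain ⟨b, hb, h2⟩ := bound_reg κ hκ hcard (fun w => y w.1)
    refine lt_of_le_of_lt ?_ hb
    exact Ordinal.iSup_le (fun i => (h2 i (hy i.1 i.2).1).le)
  · rw [Ordinal.cof_iSup_Iio hsm hlimc.isSuccPrelimit, hc.cof_ord]
  · intro w hw
    have : ∃ i : Iio c.ord, w < y i := by
      by_contra hcon
      push Not at hcon
      exact absurd hw (not_lt.2 (Ordinal.iSup_le hcon))
    obtain ⟨i, hi⟩ := this
    have hi' : Order.succ i.1 < c.ord := hlimc.succ_lt i.2
    refine ((hy _ hi').2 i.1 (Order.lt_succ _)).2 w hi.le |>.trans_le ?_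
    exact Ordinal.le_iSup (fun i : Iio c.ord => y i) ⟨_, hi'⟩

theorem card_list_lt {α : Type 1} (κ : Cardinal.{0}) (hκ : ℵ₀ < κ) (h : #α < Cardinal.lift.{1,0} κ) :
    #(List α) < Cardinal.lift.{1,0} κ := by
  refine (Cardinal.mk_list_le_max α).trans_lt (max_lt ?_ h)
  rwa [← Cardinal.lift_aleph0.{1,0}, Cardinal.lift_lt]



def MeetsF (A : Set Ordinal.{0}) (S : Set (Set Ordinal.{0})) : Prop :=
  ∀ G : List Ordinal.{0} → Set Ordinal.{0}, (∀ l, (G l).Countable) →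
    ∃ a ∈ S, ∀ l, (∀ x ∈ l, x ∈ a) → G l ∩ A ⊆ a

theorem meetsF_of_meetsClubs {A : Set Ordinal.{0}} {S : Set (Set Ordinal.{0})}
    (h : MeetsClubs A S) : MeetsF A S := by
  intro G hG
  have hclub : ClubFam A {a | a ∈ small A ∧ ∀ l, (∀ x ∈ l, x ∈ a) → G l ∩ A ⊆ a} := by
    refine ⟨fun a ha => ha.1, ?_, ?_⟩
    · intro D hD hne hch hct
      refine ⟨⟨sUnion_subset fun d hd => (hD hd).1.1, hct.sUnion fun d hd => (hD hd).1.2⟩, ?_⟩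
      intro l hl
      have : ∃ d ∈ D, ∀ x ∈ l, x ∈ d := by
        induction l with
        | nil => obtain ⟨d, hd⟩ := hne; exact ⟨d, hd, by simp⟩
        | cons x l ih =>
          obtain ⟨d, hd, hdl⟩ := ih (fun y hy => hl y (List.mem_cons_of_mem _ hy))
          obtain ⟨e, he, hxe⟩ := hl x List.mem_cons_self
          rcases hch.total hd he with h1 | h1
          · refine ⟨e, he, ?_⟩
            intro y hy
            rcases List.mem_cons.1 hy with rfl | hy
            · exact hxe
            · exact h1 (hdl y hy)
          · refine ⟨d, hd, ?_⟩
            intro y hy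
            rcases List.mem_cons.1 hy with rfl | hy
            · exact h1 hxe
            · exact hdl y hy
      obtain ⟨d, hd, hdl⟩ := this
      exact ((hD hd).2 l hdl).trans (subset_sUnion_of_mem hd)
    · intro y hy
      let step : Set Ordinal.{0} → Set Ordinal.{0} := fun a =>
        a ∪ ⋃ l : List a, (G (l.map Subtype.val) ∩ A)
      let s : ℕ → Set Ordinal.{0} := fun n => step^[n] y
      have hs : ∀ n, s (n+1) = step (s n) := fun n => Function.iterate_succ_apply' step n y
      have hsm : ∀ n, s n ∈ small A := by
        intro n
        induction n with
        | zero => exact hy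
        | succ n ih =>
          rw [hs]
          refine ⟨union_subset ih.1 (iUnion_subset fun l => inter_subset_right), ?_⟩
          have : Countable (s n) := ih.2
          exact ih.2.union (countable_iUnion fun l => (hG _).mono inter_subset_left)
      have hmono : Monotone s := by
        apply monotone_nat_of_le_succ
        intro n
        rw [hs]
        exact subset_union_left
      refine ⟨⋃ n, s n, ⟨⟨iUnion_subset fun n => (hsm n).1, countable_iUnion fun n => (hsm n).2⟩, ?_⟩,
        subset_iUnion s 0⟩
      intro l hl
      have : ∃ n, ∀ x ∈ l, x ∈ s n := by
        induction l with
        | nil => exact ⟨0, by simp⟩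
        | cons x l ih =>
          obtain ⟨n, hn⟩ := ih (fun y hy => hl y (List.mem_cons_of_mem _ hy))
          obtain ⟨m, hm⟩ := mem_iUnion.1 (hl x List.mem_cons_self)
          refine ⟨max n m, ?_⟩
          intro y hy
          rcases List.mem_cons.1 hy with rfl | hy
          · exact hmono (le_max_right _ _) hm
          · exact hmono (le_max_left _ _) (hn y hy)
      obtain ⟨n, hn⟩ := this
      refine Subset.trans ?_ (subset_iUnion s (n+1))
      rw [hs]
      refine Subset.trans ?_ subset_union_right
      lift l to List (s n) using hn
      exact subset_iUnion (fun l : List (s n) => (G (l.map Subtype.val) ∩ A)) l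
  obtain ⟨a, haS, ha⟩ := h _ hclub
  exact ⟨a, haS, ha.2⟩

theorem MeetsF.pigeon {A : Set Ordinal.{0}} {S : Set (Set Ordinal.{0})} (h : MeetsF A S)
    {ι : Type} [Countable ι] (c : Set Ordinal.{0} → ι) : ∃ i, MeetsF A {a ∈ S | c a = i} := by
  by_contra hcon
  replace hcon : ∀ i, ∃ G : List Ordinal.{0} → Set Ordinal.{0}, (∀ l, (G l).Countable) ∧
      ¬ ∃ a ∈ {a ∈ S | c a = i}, ∀ l, (∀ x ∈ l, x ∈ a) → G l ∩ A ⊆ a := by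
    intro i
    by_contra h2
    exact hcon ⟨i, fun G hG => by_contra fun h3 => h2 ⟨G, hG, h3⟩⟩
  choose G hG1 hG2 using hcon
  obtain ⟨a, haS, ha⟩ := h (fun l => ⋃ i, G i l) (fun l => countable_iUnion fun i => hG1 i l)
  refine hG2 (c a) ⟨a, ⟨haS, rfl⟩, fun l hl => Subset.trans ?_ (ha l hl)⟩
  exact inter_subset_inter_left _ (subset_iUnion (fun i => G i l) (c a))

theorem MeetsF.fodor {A : Set Ordinal.{0}} {S : Set (Set Ordinal.{0})} (h : MeetsF A S)
    (c : Set Ordinal.{0} → Ordinal.{0}) (hc : ∀ a ∈ S, c a ∈ a) :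
    ∃ i, MeetsF A {a ∈ S | c a = i} := by
  by_contra hcon
  replace hcon : ∀ i, ∃ G : List Ordinal.{0} → Set Ordinal.{0}, (∀ l, (G l).Countable) ∧
      ¬ ∃ a ∈ {a ∈ S | c a = i}, ∀ l, (∀ x ∈ l, x ∈ a) → G l ∩ A ⊆ a := by
    intro i
    by_contra h2
    exact hcon ⟨i, fun G hG => by_contra fun h3 => h2 ⟨G, hG, h3⟩⟩
  choose G hG1 hG2 using hcon
  obtain ⟨a, haS, ha⟩ := h (fun l => match l with
    | [] => ∅
    | v :: t => G v t) (by
      intro l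
      match l with
      | [] => exact countable_empty
      | v :: t => exact hG1 v t)
  refine hG2 (c a) ⟨a, ⟨haS, rfl⟩, fun l hl => ?_⟩
  have := ha (c a :: l) (by
    intro x hx
    rcases List.mem_cons.1 hx with rfl | hx
    · exact hc a haS
    · exact hl x hx)
  exact this

theorem MeetsF.above {A : Set Ordinal.{0}} {S : Set (Set Ordinal.{0})} (h : MeetsF A S)
    {b : Set Ordinal.{0}} (hb : b.Countable) (hbA : b ⊆ A) : ∃ a ∈ S, b ⊆ a := by
  obtain ⟨a, haS, ha⟩ := h (fun _ => b) (fun _ => hb)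
  refine ⟨a, haS, ?_⟩
  have := ha [] (by simp)
  rwa [inter_eq_left.2 hbA] at this

theorem no_mono (A a0 : Set Ordinal.{0}) (hA : ¬ A.Countable) (ha0 : a0.Countable) :
    ∃ A0 ⊆ A, A0.Countable ∧ ¬ ∃ ψ : Ordinal.{0} → Ordinal.{0}, MapsTo ψ A0 a0 ∧ StrictMonoOn ψ A0 := by
  have : ∃ B ⊆ A, ¬ B.Countable ∧ ∀ x ∈ B, {y ∈ B | y ≤ x}.Countable := by
    by_cases hx : ∃ x, ¬ {y ∈ A | y ≤ x}.Countable
    · let x := sInf {x | ¬ {y ∈ A | y ≤ x}.Countable}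
      have hxm : x ∈ {x | ¬ {y ∈ A | y ≤ x}.Countable} := csInf_mem hx
      refine ⟨{y ∈ A | y < x}, fun y hy => hy.1, ?_, ?_⟩
      · intro hc
        apply hxm
        refine (hc.insert x).mono ?_
        rintro y ⟨hy, hyx⟩
        rcases hyx.eq_or_lt with h | h
        · left; exact h
        · right; exact ⟨hy, h⟩
      · rintro y ⟨hy, hyx⟩
        have := notMem_of_lt_csInf' hyx
        simp only [mem_ofPred_eq, not_not] at this
        refine this.mono ?_
        rintro z ⟨hz, hzy⟩
        exact ⟨hz.1, hzy⟩
    · push Not at hx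
      exact ⟨A, Subset.rfl, hA, fun x _ => hx x⟩
  obtain ⟨B, hBA, hB, hBx⟩ := this
  by_contra hcon
  push Not at hcon
  have h1 : ∀ x ∈ B, ∃ ψ : Ordinal.{0} → Ordinal.{0}, MapsTo ψ {y ∈ B | y ≤ x} a0 ∧
      StrictMonoOn ψ {y ∈ B | y ≤ x} := by
    intro x hx
    exact hcon _ (fun y hy => hBA hy.1) (hBx x hx)
  let V : Ordinal.{0} → Set Ordinal.{0} := fun x => {v | ∃ ψ : Ordinal.{0} → Ordinal.{0},
    MapsTo ψ {y ∈ B | y ≤ x} a0 ∧ StrictMonoOn ψ {y ∈ B | y ≤ x} ∧ ψ x = v}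
  have hV : ∀ x ∈ B, sInf (V x) ∈ V x := by
    intro x hx
    obtain ⟨ψ, h2, h3⟩ := h1 x hx
    exact csInf_mem ⟨ψ x, ψ, h2, h3, rfl⟩
  have hmono : StrictMonoOn (fun x => sInf (V x)) B := by
    intro x hx x' hx' hlt
    obtain ⟨ψ, h2, h3, h4⟩ := hV x' hx'
    have hsub : {y ∈ B | y ≤ x} ⊆ {y ∈ B | y ≤ x'} := fun y hy => ⟨hy.1, hy.2.trans hlt.le⟩
    have : sInf (V x) ≤ ψ x := csInf_le' ⟨ψ, h2.mono hsub Subset.rfl, h3.mono hsub, rfl⟩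
    refine this.trans_lt ?_
    show ψ x < sInf (V x')
    rw [← h4]
    exact h3 ⟨hx, hlt.le⟩ ⟨hx', le_rfl⟩ hlt
  have hmaps : MapsTo (fun x => sInf (V x)) B a0 := by
    intro x hx
    obtain ⟨ψ, h2, h3, h4⟩ := hV x hx
    show sInf (V x) ∈ a0
    rw [← h4]
    exact h2 ⟨hx, le_rfl⟩
  exact hB (hmaps.countable_of_injOn hmono.injOn ha0)

theorem bddAbove_ctbl {a : Set Ordinal.{0}} (ha : a.Countable) : BddAbove a := by
  have : Countable a := ha
  exact Ordinal.bddAbove_of_small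

theorem nonrefl (A : Set Ordinal.{0}) (hA : ¬ A.Countable) (S : Set (Set Ordinal.{0}))
    (hS : S ⊆ ctblInf A) (hMF : MeetsF A S) (f : Ordinal.{0} → ℕ → Ordinal.{0})
    (hfree : Free (sSup '' S) f) (P : Ordinal.{0} → Prop)
    (hstr : ∀ a ∈ S, ∃ x ρ : ℕ → Ordinal.{0}, ∃ m : ℕ, range x = a ∧ ∀ n ≥ m,
      IsLeast {y ∈ a | f (sSup a) n ≤ y} (ρ n) ∧ (P (ρ n) ↔ x n.unpair.1 < x n.unpair.2)) :
    False := by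
  classical
  choose! X ρ m hX hρ using hstr
  obtain ⟨nf, hnf⟩ := hfree
  let kk : Set Ordinal.{0} → ℕ := fun a => max (nf (sSup a)) (m a)
  obtain ⟨⟨k, s⟩, hk⟩ := hMF.pigeon (fun a => (⟨kk a, (Finset.range (kk a)).filter
    (fun n => X a n.unpair.1 < X a n.unpair.2)⟩ : ℕ × Finset ℕ))
  set S' := {a | a ∈ S ∧ (⟨kk a, (Finset.range (kk a)).filter
    (fun n => X a n.unpair.1 < X a n.unpair.2)⟩ : ℕ × Finset ℕ) = ⟨k, s⟩} with hS'
  have hkk : ∀ a ∈ S', kk a = k := fun a ha => congrArg Prod.fst ha.2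
  have hs : ∀ a ∈ S', ∀ n < k, (n ∈ s ↔ X a n.unpair.1 < X a n.unpair.2) := by
    intro a ha n hn
    have : (Finset.range (kk a)).filter
      (fun n => X a n.unpair.1 < X a n.unpair.2) = s := congrArg Prod.snd ha.2
    rw [← this, hkk a ha]
    simp [hn]
  have hle : ∀ a ∈ S', ∀ b ∈ S', a ⊆ b → ∀ n ≥ k, f (sSup a) n ≤ f (sSup b) n := by
    intro a ha b hb hab n hn
    have h1 : sSup a ≤ sSup b := csSup_le_csSup (bddAbove_ctbl (hS hb.1).2.1)
      (hS ha.1).2.2.nonempty hab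
    rcases h1.eq_or_lt with h | h
    · rw [h]
    · refine (hnf _ ⟨a, ha.1, rfl⟩ _ ⟨b, hb.1, rfl⟩ h n ?_ ?_).le
      · exact (le_max_left _ _).trans ((hkk a ha).le.trans hn)
      · exact (le_max_left _ _).trans ((hkk b hb).le.trans hn)
  have hρ' : ∀ a ∈ S', ∀ n ≥ k,
      IsLeast {y ∈ a | f (sSup a) n ≤ y} (ρ a n) ∧
        (P (ρ a n) ↔ X a n.unpair.1 < X a n.unpair.2) := by
    intro a ha n hn
    exact hρ a ha.1 n ((le_max_right _ _).trans ((hkk a ha).le.trans hn))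
  have hγ : ∀ n, ∃ γ, k ≤ n → MeetsF A {a ∈ S' | ρ a n = γ} := by
    intro n
    by_cases hn : k ≤ n
    · obtain ⟨γ, h⟩ := hk.fodor (fun a => ρ a n) (fun a ha => (hρ' a ha n hn).1.1.1)
      exact ⟨γ, fun _ => h⟩
    · exact ⟨0, fun h => absurd h hn⟩
  choose γ hγ using hγ
  have hγA : ∀ n ≥ k, γ n ∈ A := by
    intro n hn
    obtain ⟨a, ha, _⟩ := (hγ n hn).above (b := ∅) countable_empty (empty_subset _)
    rw [← ha.2]
    exact (hS ha.1.1).1 (hρ' a ha.1 n hn).1.1.1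
  have hb : ∀ n x, ∃ b : Set Ordinal.{0}, b.Countable ∧ (k ≤ n → x ∈ A → 
      (b ∈ S' ∧ ρ b n = γ n) ∧ x ∈ b) := by
    intro n x
    by_cases h : k ≤ n ∧ x ∈ A
    · obtain ⟨a, ha, hxa⟩ := (hγ n h.1).above (b := {x}) (countable_singleton x)
        (singleton_subset_iff.2 h.2)
      exact ⟨a, (hS ha.1.1).2.1, fun _ _ => ⟨ha, hxa rfl⟩⟩
    · exact ⟨∅, countable_empty, fun h1 h2 => absurd ⟨h1, h2⟩ h⟩
  choose b hb1 hb2 using hb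
  have good : ∀ A0 ⊆ A, A0.Countable → ∃ a ∈ S', A0 ⊆ a ∧ ∀ n ≥ k, ρ a n = γ n := by
    intro A0 hA0 hA0c
    obtain ⟨a, ha, hcl⟩ := hk (fun l => match l with
      | [] => A0 ∪ range γ
      | x :: _ => ⋃ n, b n x) (by
        intro l
        match l with
        | [] => exact hA0c.union (countable_range γ)
        | x :: _ => exact countable_iUnion fun n => hb1 n x)
    have h0 : (A0 ∪ range γ) ∩ A ⊆ a := hcl [] (by simp)
    have h1 : ∀ x ∈ a, (⋃ n, b n x) ∩ A ⊆ a := fun x hx => hcl [x] (by simpa using hx)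
    have haA : a ⊆ A := (hS ha.1).1
    refine ⟨a, ha, fun x hx => h0 ⟨Or.inl hx, hA0 hx⟩, ?_⟩
    intro n hn
    have hleast : IsLeast {y ∈ a | f (sSup a) n ≤ y} (γ n) := by
      refine ⟨⟨h0 ⟨Or.inr ⟨n, rfl⟩, hγA n hn⟩, ?_⟩, ?_⟩
      · obtain ⟨c, hc, hac⟩ := (hγ n hn).above (hS ha.1).2.1 haA
        refine (hle a ha c hc.1 hac n hn).trans ?_
        rw [← hc.2]
        exact (hρ' c hc.1 n hn).1.1.2
      · rintro y ⟨hya, hfy⟩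
        by_contra hlt
        push Not at hlt
        obtain ⟨⟨h2, h3⟩, h4⟩ := hb2 n y hn (haA hya)
        have hba : b n y ⊆ a := fun z hz =>
          h1 y hya ⟨mem_iUnion.2 ⟨n, hz⟩, (hS h2.1).1 hz⟩
        have h5 := hle _ h2 a ha hba n hn
        have h6 := (hρ' _ h2 n hn).1.2 ⟨h4, h5.trans hfy⟩
        rw [h3] at h6
        exact absurd hlt (not_lt.2 h6)
    exact (hρ' a ha n hn).1.unique hleast
  obtain ⟨a0, ha0, -, hg0⟩ := good ∅ (empty_subset _) countable_empty
  obtain ⟨A0, hA0, hA0c, hno⟩ := no_mono A a0 hA (hS ha0.1).2.1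
  obtain ⟨a, ha, hAa, hg⟩ := good A0 hA0 hA0c
  have hsame : ∀ i j, X a i < X a j → X a0 i < X a0 j := by
    intro i j hij
    by_cases hn : Nat.pair i j < k
    · have e1 := hs a ha _ hn
      have e2 := hs a0 ha0 _ hn
      simp only [Nat.unpair_pair] at e1 e2
      exact e2.1 (e1.2 hij)
    · push Not at hn
      have e1 := (hρ' a ha _ hn).2
      have e2 := (hρ' a0 ha0 _ hn).2
      rw [hg _ hn] at e1
      rw [hg0 _ hn] at e2
      simp only [Nat.unpair_pair] at e1 e2
      exact e2.1 (e1.2 hij)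
  have hidx : ∀ y, ∃ i, y ∈ a → X a i = y := by
    intro y
    by_cases hy : y ∈ a
    · have hy' := hy
      rw [← hX a ha.1] at hy'
      obtain ⟨i, hi⟩ := hy'
      exact ⟨i, fun _ => hi⟩
    · exact ⟨0, fun h => absurd h hy⟩
  choose idx hidx using hidx
  refine hno ⟨fun y => X a0 (idx y), ?_, ?_⟩
  · intro y hy
    show X a0 (idx y) ∈ a0
    have h1 : X a0 (idx y) ∈ range (X a0) := mem_range_self (idx y)
    rwa [hX a0 ha0.1] at h1
  · intro y hy y' hy' hlt
    apply hsame
    rwa [hidx y (hAa hy), hidx y' (hAa hy')]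

theorem card_sups (A : Set Ordinal.{0}) (S : Set (Set Ordinal.{0}))
    (hS : S ⊆ ctblInf A) (hnm : ∀ a ∈ S, ∀ y ∈ a, ∃ z ∈ a, y < z) (κ : Cardinal.{0})
    (hκ : ℵ₀ ≤ κ) (hA : #A < Cardinal.lift.{1,0} κ) :
    #(sSup '' S : Set Ordinal.{0}) < Cardinal.lift.{1,0} κ := by
  classical
  have hκ' : ℵ₀ ≤ Cardinal.lift.{1,0} κ := by simpa using hκ
  have hopt : #(Option A) < Cardinal.lift.{1,0} κ := by
    rw [Cardinal.mk_option]
    exact Cardinal.add_lt_of_lt hκ' hA (Cardinal.one_lt_aleph0.trans_le hκ')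
  refine lt_of_le_of_lt ?_ hopt
  have hsep : ∀ δ ∈ sSup '' S, ∀ δ' ∈ sSup '' S, δ < δ' → ∃ z ∈ A, δ ≤ z ∧ z < δ' := by
    rintro δ - _ ⟨a, ha, rfl⟩ hlt
    obtain ⟨z, hz, hz2⟩ := exists_lt_of_lt_csSup (hS ha).2.2.nonempty hlt
    obtain ⟨w, hw, hzw⟩ := hnm a ha z hz
    exact ⟨z, (hS ha).1 hz, hz2.le, hzw.trans_le (le_csSup (bddAbove_ctbl (hS ha).2.1) hw)⟩
  let h : (sSup '' S : Set Ordinal.{0}) → Option A := fun δ =>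
    if hd : {y ∈ A | δ.1 ≤ y}.Nonempty then some ⟨sInf {y ∈ A | δ.1 ≤ y}, (csInf_mem hd).1⟩ else none
  have key : ∀ δ δ' : (sSup '' S : Set Ordinal.{0}), δ.1 < δ'.1 → h δ ≠ h δ' := by
    intro δ δ' hlt heq
    obtain ⟨z, hz, h1, h2⟩ := hsep _ δ.2 _ δ'.2 hlt
    have hd : {y ∈ A | δ.1 ≤ y}.Nonempty := ⟨z, hz, h1⟩
    by_cases hd' : {y ∈ A | δ'.1 ≤ y}.Nonempty
    · simp only [h, hd, hd', dif_pos, Option.some.injEq, Subtype.mk.injEq] at heq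
      have h3 : sInf {y ∈ A | δ.1 ≤ y} ≤ z := csInf_le' ⟨hz, h1⟩
      have h4 := (csInf_mem hd').2
      rw [heq] at h3
      exact absurd (h3.trans_lt h2) (not_lt.2 h4)
    · simp [h, hd, hd'] at heq
  refine Cardinal.mk_le_of_injective (f := h) ?_
  intro δ δ' heq
  rcases lt_trichotomy δ.1 δ'.1 with hl | hl | hl
  · exact absurd heq (key _ _ hl)
  · exact Subtype.ext hl
  · exact absurd heq.symm (key _ _ hl)



def hist (x : ℕ → Ordinal.{0}) : ℕ → List Ordinal.{0}
  | 0 => []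
  | n+1 => x n :: hist x n

theorem club_fn (Λ : Ordinal.{0}) (hΛ : 0 < Λ) (C : Set (Set Ordinal.{0}))
    (hC : ClubFam (Iio Λ) C) :
    ∃ e : List Ordinal.{0} → ℕ → Ordinal.{0}, (∀ l j, e l j < Λ) ∧
      ∀ x : ℕ → Ordinal.{0}, (∀ n, x n < Λ) → (∀ m j, e (hist x m) j ∈ range x) →
        range x ∈ C := by
  obtain ⟨h1, h2, h3⟩ := hC
  have hup : ∀ y : Set Ordinal.{0}, ∃ x, y ∈ small (Iio Λ) → x ∈ C ∧ y ⊆ x := by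
    intro y
    by_cases hy : y ∈ small (Iio Λ)
    · obtain ⟨x, hx⟩ := h3 y hy
      exact ⟨x, fun _ => hx⟩
    · exact ⟨∅, fun h => absurd h hy⟩
  choose up hup using hup
  let D : List Ordinal.{0} → Set Ordinal.{0} := fun l =>
    List.rec (up {0}) (fun x _ r => up (r ∪ ({x} ∩ Iio Λ))) l
  have hD0 : D [] = up {0} := rfl
  have hD1 : ∀ x l, D (x :: l) = up (D l ∪ ({x} ∩ Iio Λ)) := fun x l => rfl
  have h0 : ({0} : Set Ordinal.{0}) ∈ small (Iio Λ) :=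
    ⟨by simpa using hΛ, countable_singleton 0⟩
  have hsm : ∀ x l, D l ∈ C → D l ∪ ({x} ∩ Iio Λ) ∈ small (Iio Λ) := by
    intro x l hl
    exact ⟨union_subset (h1 hl).1 inter_subset_right,
      (h1 hl).2.union ((countable_singleton x).mono inter_subset_left)⟩
  have hDC : ∀ l, D l ∈ C := by
    intro l
    induction l with
    | nil => exact (hup _ h0).1
    | cons x l ih => rw [hD1]; exact (hup _ (hsm x l ih)).1
  have hDs : ∀ x l, D l ∪ ({x} ∩ Iio Λ) ⊆ D (x :: l) := by
    intro x l
    rw [hD1]; exact (hup _ (hsm x l (hDC l))).2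
  have hDne : ∀ l, (D l).Nonempty := by
    intro l
    induction l with
    | nil => exact ⟨0, (hup _ h0).2 rfl⟩
    | cons x l ih => exact ih.mono (subset_union_left.trans (hDs x l))
  have hen : ∀ l, ∃ e : ℕ → Ordinal.{0}, D l = range e := fun l =>
    (h1 (hDC l)).2.exists_eq_range (hDne l)
  choose e he using hen
  refine ⟨e, fun l j => (h1 (hDC l)).1 (by rw [he]; exact mem_range_self j), ?_⟩
  intro x hx hcl
  have hmono : Monotone (fun m => D (hist x m)) :=
    monotone_nat_of_le_succ fun n => subset_union_left.trans (hDs (x n) (hist x n))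
  have heq : range x = ⋃₀ (range (fun m => D (hist x m))) := by
    apply Subset.antisymm
    · rintro _ ⟨m, rfl⟩
      refine ⟨D (hist x (m+1)), ⟨m+1, rfl⟩, hDs _ _ (Or.inr ⟨rfl, hx m⟩)⟩
    · rintro y ⟨_, ⟨m, rfl⟩, hy⟩
      have hy' : y ∈ D (hist x m) := hy
      rw [he] at hy'
      obtain ⟨j, rfl⟩ := hy'
      exact hcl m j
  rw [heq]
  apply h2
  · rintro _ ⟨m, rfl⟩; exact hDC _
  · exact range_nonempty _
  · rintro _ ⟨m, rfl⟩ _ ⟨m', rfl⟩ _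
    rcases le_total m m' with h | h
    · left; exact hmono h
    · right; exact hmono h
  · exact countable_range _

abbrev T2 := Ordinal.{0} × Ordinal.{0}
abbrev T3 := Ordinal.{0} × Ordinal.{0} × Ordinal.{0}

def val (e : List Ordinal.{0} → ℕ → Ordinal.{0}) (v : ℕ → T2) (n : ℕ) (l : List Ordinal.{0}) :
    Ordinal.{0} :=
  match n.unpair with
  | (0, j) => (v j).1
  | (1, j) => if j < n then (v j).2 else 0
  | (i+2, j) => e (l.drop (n - i)) j

def xsf (e : List Ordinal.{0} → ℕ → Ordinal.{0}) (v : ℕ → T2) : ℕ → List Ordinal.{0}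
  | 0 => []
  | n+1 => val e v n (xsf e v n) :: xsf e v n

def xv (e : List Ordinal.{0} → ℕ → Ordinal.{0}) (v : ℕ → T2) (n : ℕ) : Ordinal.{0} :=
  val e v n (xsf e v n)

theorem xsf_eq (e v n) : xsf e v n = hist (xv e v) n := by
  induction n with
  | zero => rfl
  | succ n ih => rw [xsf, hist, ← ih]; rfl

theorem hist_drop (x : ℕ → Ordinal.{0}) (i k : ℕ) : (hist x (i + k)).drop k = hist x i := by
  induction k with
  | zero => rfl
  | succ k ih => rw [← add_assoc, hist, List.drop_succ_cons, ih]

theorem xv_pair_zero (e v j) : xv e v (Nat.pair 0 j) = (v j).1 := by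
  simp [xv, val]

theorem xv_pair_one (e v j) : xv e v (Nat.pair 1 j) = (v j).2 := by
  have : j < Nat.pair 1 j := by
    unfold Nat.pair
    split_ifs <;> nlinarith
  simp [xv, val, this]

theorem xv_pair_two (e v i j) : xv e v (Nat.pair (i+2) j) = e (hist (xv e v) i) j := by
  have h : i + 2 ≤ Nat.pair (i+2) j := Nat.left_le_pair _ _
  have h2 : ∃ k, Nat.pair (i+2) j = i + k := ⟨Nat.pair (i+2) j - i, by omega⟩
  obtain ⟨k, hk⟩ := h2
  have : xv e v (Nat.pair (i+2) j) = e ((xsf e v (Nat.pair (i+2) j)).drop (Nat.pair (i+2) j - i)) j := by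
    simp [xv, val]
  rw [this, xsf_eq, hk, Nat.add_sub_cancel_left, hist_drop]

theorem xsf_congr (e) (v v' : ℕ → T2) (n : ℕ) (h1 : ∀ j < n, v j = v' j) :
    xsf e v n = xsf e v' n := by
  induction n with
  | zero => rfl
  | succ n ih =>
    have ih' := ih (fun j hj => h1 j (by omega))
    rw [xsf, xsf, ih']
    congr 1
    unfold val
    have hr := Nat.unpair_right_le n
    rcases hnn : n.unpair with ⟨i, j⟩
    rw [hnn] at hr
    rcases i with _ | _ | i
    · show (v j).1 = (v' j).1
      rw [h1 j (by simp at hr; omega)]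
    · show (if j < n then (v j).2 else 0) = (if j < n then (v' j).2 else 0)
      split_ifs with hj
      · rw [h1 j (by omega)]
      · rfl
    · rfl

theorem xv_congr (e) (v v' : ℕ → T2) (n : ℕ) (h1 : ∀ j < n, v j = v' j) (h2 : (v n).1 = (v' n).1) :
    xv e v n = xv e v' n := by
  unfold xv
  rw [xsf_congr e v v' n h1]
  unfold val
  have hr := Nat.unpair_right_le n
  rcases hnn : n.unpair with ⟨i, j⟩
  rw [hnn] at hr
  rcases i with _ | _ | i
  · show (v j).1 = (v' j).1
    rcases (show j ≤ n from hr).eq_or_lt with rfl | h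
    · exact h2
    · rw [h1 j h]
  · show (if j < n then (v j).2 else 0) = (if j < n then (v' j).2 else 0)
    split_ifs with hj
    · rw [h1 j (by omega)]
    · rfl
  · rfl

def ext (r : List T2) : ℕ → T2 := fun j => r.getD j (0, 0)

def bit (e : List Ordinal.{0} → ℕ → Ordinal.{0}) (r : List T2) (q : Ordinal.{0}) : Prop :=
  xv e (ext (r ++ [(q, 0)])) r.length.unpair.1 < xv e (ext (r ++ [(q, 0)])) r.length.unpair.2

def proj (p : T3) : T2 := (p.1, p.2.2)

def Legal (e : List Ordinal.{0} → ℕ → Ordinal.{0}) (s : List T3) : Prop :=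
  ∀ i m : ℕ, i < s.length → ∀ hm : m < s.length,
    xv e (ext (s.map proj)) i < s[m].2.2 → xv e (ext (s.map proj)) i < s[m].2.1

theorem bit_iff (e) (v : ℕ → T2) (n : ℕ) :
    bit e ((List.range n).map v) (v n).1 ↔ xv e v n.unpair.1 < xv e v n.unpair.2 := by
  have key : ∀ i ≤ n, xv e (ext ((List.range n).map v ++ [((v n).1, 0)])) i = xv e v i := by
    intro i hi
    have h1 : ∀ j < n, ext ((List.range n).map v ++ [((v n).1, 0)]) j = v j := by
      intro j hj
      simp [ext, List.getD_eq_getElem?_getD, List.getElem?_append, hj]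
    have h2 : (ext ((List.range n).map v ++ [((v n).1, 0)]) n).1 = (v n).1 := by
      simp [ext, List.getD_eq_getElem?_getD]
    apply xv_congr
    · intro j hj; exact h1 j (by omega)
    · rcases hi.eq_or_lt with rfl | h
      · exact h2
      · rw [h1 i h]
  unfold bit
  simp only [List.length_map, List.length_range]
  rw [key _ (Nat.unpair_left_le n), key _ (Nat.unpair_right_le n)]

theorem legal_range (e) (u : ℕ → T3) (n : ℕ) :
    Legal e ((List.range n).map u) ↔ ∀ i < n, ∀ m < n,
      xv e (proj ∘ u) i < (u m).2.2 → xv e (proj ∘ u) i < (u m).2.1 := by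
  have key : ∀ i < n, xv e (ext (((List.range n).map u).map proj)) i = xv e (proj ∘ u) i := by
    intro i hi
    have h1 : ∀ j < n, ext (((List.range n).map u).map proj) j = (proj ∘ u) j := by
      intro j hj
      simp [ext, List.getD_eq_getElem?_getD, hj]
    apply xv_congr
    · intro j hj; exact h1 j (by omega)
    · rw [h1 i hi]
  unfold Legal
  constructor
  · intro h i hi m hm
    have := h i m (by simpa using hi) (by simpa using hm)
    rw [key i hi] at this
    simpa using this
  · intro h i m hi hm
    simp only [List.length_map, List.length_range] at hi hm
    rw [key i hi]
    simpa using h i hi m hm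

def Col (e : List Ordinal.{0} → ℕ → Ordinal.{0}) (s : List T3) (q ρ : Ordinal.{0}) : Prop :=
  (bit e (s.map proj) q → ρ.cof = aleph 1) ∧ (¬ bit e (s.map proj) q → ρ.cof = aleph 2)

def Move (e : List Ordinal.{0} → ℕ → Ordinal.{0}) (L : ℕ → Ordinal.{0}) (Λ : Ordinal.{0}) (s : List T3) (α : Ordinal.{0})
    (ξ : Ordinal.{0} → Ordinal.{0} → Ordinal.{0}) (p : T3) : Prop :=
  α < p.1 ∧ p.1 < Λ ∧ p.2.1 < L s.length ∧ ξ p.1 p.2.1 < p.2.2 ∧ p.2.2 < L s.length ∧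
    Col e s p.1 p.2.2

inductive Lose (e : List Ordinal.{0} → ℕ → Ordinal.{0}) (L : ℕ → Ordinal.{0}) (Λ : Ordinal.{0}) :
    List T3 → Prop
  | ill (s : List T3) (h : ¬ Legal e s) : Lose e L Λ s
  | step (s : List T3) (α : Ordinal.{0}) (ξ : Ordinal.{0} → Ordinal.{0} → Ordinal.{0})
      (hα : α < Λ) (hξ : ∀ q η, η < L s.length → ξ q η < L s.length)
      (h : ∀ p, Move e L Λ s α ξ p → Lose e L Λ (s ++ [p])) : Lose e L Λ s

def GoodSt (e : List Ordinal.{0} → ℕ → Ordinal.{0}) (L : ℕ → Ordinal.{0}) (Λ : Ordinal.{0}) (s : List T3) (σα : List T3 → Ordinal.{0})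
    (σξ : List T3 → Ordinal.{0} → Ordinal.{0} → Ordinal.{0}) : Prop :=
  (∀ t, σα t < Λ) ∧ (∀ t q η, η < L (s.length + t.length) → σξ t q η < L (s.length + t.length)) ∧
  ∀ u : ℕ → T3, (∀ n, Move e L Λ (s ++ (List.range n).map u) (σα ((List.range n).map u))
    (σξ ((List.range n).map u)) (u n)) → ∃ n, ¬ Legal e (s ++ (List.range n).map u)

theorem strat (e L) (Λ : Ordinal.{0}) (hΛ : 0 < Λ) (s : List T3) (h : Lose e L Λ s) :
    ∃ σα σξ, GoodSt e L Λ s σα σξ := by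
  induction h with
  | ill s h =>
    refine ⟨fun _ => 0, fun _ _ η => η, fun _ => hΛ, fun _ _ _ h => h, fun u _ => ⟨0, by simpa using h⟩⟩
  | step s α ξ hα hξ h ih =>
    have ih' : ∀ p : T3, ∃ σα : List T3 → Ordinal.{0},
        ∃ σξ : List T3 → Ordinal.{0} → Ordinal.{0} → Ordinal.{0},
        (∀ t, σα t < Λ) ∧ (∀ t q η, η < L ((s ++ [p]).length + t.length) →
          σξ t q η < L ((s ++ [p]).length + t.length)) ∧
          (Move e L Λ s α ξ p → GoodSt e L Λ (s ++ [p]) σα σξ) := by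
      intro p
      by_cases hp : Move e L Λ s α ξ p
      · obtain ⟨a, b, hab⟩ := ih p hp
        exact ⟨a, b, hab.1, hab.2.1, fun _ => hab⟩
      · exact ⟨fun _ => 0, fun _ _ η => η, fun _ => hΛ, fun _ _ _ h => h, fun h => absurd h hp⟩
    choose a b h1 h2 h3 using ih'
    let σα : List T3 → Ordinal.{0} := fun t => match t with
      | [] => α
      | p :: t => a p t
    let σξ : List T3 → Ordinal.{0} → Ordinal.{0} → Ordinal.{0} := fun t => match t with
      | [] => ξ
      | p :: t => b p t
    refine ⟨σα, σξ, ?_, ?_, ?_⟩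
    · intro t
      match t with
      | [] => exact hα
      | p :: t => exact h1 p t
    · intro t
      match t with
      | [] => exact hξ
      | p :: t =>
        intro q η
        have := h2 p t q η
        have e1 : (s ++ [p]).length + t.length = s.length + (p :: t).length := by
          simp only [List.length_append, List.length_cons, List.length_nil]; omega
        rw [e1] at this
        exact this
    · intro u hu
      have hu0 : Move e L Λ s α ξ (u 0) := by simpa [σα, σξ] using hu 0
      have hr : ∀ n, (List.range (n+1)).map u = u 0 :: (List.range n).map (fun n => u (n+1)) := by
        intro n
        rw [List.range_succ_eq_map]
        simp [Function.comp_def]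
      obtain ⟨n, hn⟩ := (h3 _ hu0).2.2 (fun n => u (n+1)) (by
        intro n
        have := hu (n+1)
        rw [hr] at this
        rw [← List.append_cons]
        exact this)
      refine ⟨n+1, ?_⟩
      rw [hr, List.append_cons]
      exact hn

theorem not_lose_step (e L) (Λ : Ordinal.{0}) (s : List T3) (hs : ¬ Lose e L Λ s)
    (hL : 0 < L s.length)
    (α : Ordinal.{0}) (hα : α < Λ) : ∃ q η, α < q ∧ q < Λ ∧ η < L s.length ∧ ∀ ξ < L s.length,
      ∃ ρ, ξ < ρ ∧ ρ < L s.length ∧ Col e s q ρ ∧ ¬ Lose e L Λ (s ++ [(q, η, ρ)]) := by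
  by_contra hcon
  push Not at hcon
  have : ∀ q η, ∃ ξ < L s.length, α < q → q < Λ → η < L s.length → ∀ ρ, ξ < ρ → ρ < L s.length →
      Col e s q ρ → Lose e L Λ (s ++ [(q, η, ρ)]) := by
    intro q η
    by_cases h : α < q ∧ q < Λ ∧ η < L s.length
    · obtain ⟨ξ, h1, h2⟩ := hcon q η h.1 h.2.1 h.2.2
      exact ⟨ξ, h1, fun _ _ _ => h2⟩
    · exact ⟨0, hL, fun h1 h2 h3 => absurd ⟨h1, h2, h3⟩ h⟩
  choose ξ h1 h2 using this
  apply hs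
  refine Lose.step s α ξ hα (fun q η _ => h1 q η) ?_
  rintro ⟨q, η, ρ⟩ ⟨a1, a2, a3, a4, a5, a6⟩
  exact h2 q η a1 a2 a3 ρ a4 a5 a6



def Kc (κ : ℕ → Cardinal.{0}) : ℕ → Cardinal.{0}
  | 0 => 0
  | m+1 => κ m

theorem Kc_lt (κ : ℕ → Cardinal.{0}) (hmono : StrictMono κ) (h0 : ∀ n, 0 < κ n) (n : ℕ) :
    Kc κ n < κ n := by
  cases n with
  | zero => exact h0 0
  | succ m => exact hmono (Nat.lt_succ_self m)

theorem le_Kc (κ : ℕ → Cardinal.{0}) (hmono : StrictMono κ) {i n : ℕ} (h : i < n) :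
    κ i ≤ Kc κ n := by
  cases n with
  | zero => omega
  | succ m => exact hmono.monotone (by omega)

theorem mk_Iio_ord_lt {c κ : Cardinal.{0}} (h : c < κ) : #(Iio c.ord) < Cardinal.lift.{1,0} κ := by
  rw [Cardinal.mk_Iio_ordinal, Cardinal.lift_lt]
  simpa using h

def zipp (r : List T2) (h : List Ordinal.{0}) : List T3 :=
  List.zipWith (fun p η => (p.1, η, p.2)) r h

theorem zipp_range (v : ℕ → T2) (η : ℕ → Ordinal.{0}) (n : ℕ) :
    zipp ((List.range n).map v) ((List.range n).map η) =
      (List.range n).map (fun j => ((v j).1, η j, (v j).2)) := by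
  simp [zipp, List.zipWith_map, List.zipWith_self]

theorem not_lose_nil (κ : ℕ → Cardinal.{0}) (lam : Cardinal.{0}) (hκ : ∀ n, (κ n).IsRegular)
    (hbig : ∀ n, aleph 2 < κ n) (hmono : StrictMono κ) (hlam : lam.IsRegular)
    (hκlam : ∀ n, κ n < lam) (e : List Ordinal.{0} → ℕ → Ordinal.{0}) :
    ¬ Lose e (fun n => (κ n).ord) lam.ord [] := by
  classical
  intro hlose
  have hpos : ∀ n, 0 < κ n := fun n => (hκ n).pos
  obtain ⟨σα, σξ, h1, h2, h3⟩ := strat e (fun n => (κ n).ord) lam.ord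
    (by rw [Cardinal.lt_ord]; simpa using hlam.pos) [] hlose
  simp only [List.length_nil, zero_add, List.nil_append] at h2 h3
  have hcard : ∀ n, #(List (Iio (Kc κ n).ord)) < Cardinal.lift.{1,0} (κ n) := fun n =>
    card_list_lt _ ((Cardinal.aleph0_le_aleph 2).trans_lt (hbig n)) (mk_Iio_ord_lt (Kc_lt κ hmono hpos n))
  -- one step of the construction
  have stage : ∀ r : List T2, ∃ w : T2,
      (w.1 < lam.ord ∧ ∀ h : List (Iio (Kc κ r.length).ord), σα (zipp r (h.map Subtype.val)) < w.1) ∧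
      w.2 < (κ r.length).ord ∧ (bit e r w.1 → w.2.cof = aleph 1) ∧
      (¬ bit e r w.1 → w.2.cof = aleph 2) ∧
      ∀ h : List (Iio (Kc κ r.length).ord), h.length = r.length → ∀ η < w.2,
        σξ (zipp r (h.map Subtype.val)) w.1 η < w.2 := by
    intro r
    obtain ⟨q, hq, hq2⟩ := bound_reg lam hlam ((hcard r.length).trans (by simpa using hκlam r.length))
      (fun h => σα (zipp r (h.map Subtype.val)))
    have hz : ∀ y, ∃ b < (κ r.length).ord, ∀ h : List (Iio (Kc κ r.length).ord),
        σξ (zipp r (h.map Subtype.val)) q y < (κ r.length).ord →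
        σξ (zipp r (h.map Subtype.val)) q y < b := fun y =>
      bound_reg (κ r.length) (hκ _) (hcard r.length) (fun h => σξ (zipp r (h.map Subtype.val)) q y)
    choose z hz1 hz2 using hz
    have hc1 : (aleph 1).IsRegular := isRegular_aleph_one
    have hc2 : (aleph 2).IsRegular := by
      have := isRegular_aleph_add_one 1
      rwa [one_add_one_eq_two] at this
    have hcc : (if bit e r q then aleph 1 else aleph 2).IsRegular := by
      split_ifs <;> assumption
    have hcl : (if bit e r q then aleph 1 else aleph 2) < κ r.length := by
      split_ifs
      · refine lt_trans ?_ (hbig _)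
        rw [aleph_lt_aleph]; exact one_lt_two
      · exact hbig _
    obtain ⟨ρ, hρ, hcof, hcl⟩ := closed_point (κ r.length) _ (hκ _) hcc hcl z (fun y _ => hz1 y)
    refine ⟨(q, ρ), ⟨hq, fun h => hq2 h (h1 _)⟩, hρ, ?_, ?_, ?_⟩
    · intro hb; simpa [show bit e r q from hb] using hcof
    · intro hb; simpa [show ¬ bit e r q from hb] using hcof
    · intro h hh η hη
      have hlen : (zipp r (h.map Subtype.val)).length = r.length := by
        simp [zipp, hh]
      have := h2 (zipp r (h.map Subtype.val)) q η
      rw [hlen] at this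
      exact (hz2 η h (this (lt_trans hη hρ))).trans (hcl η hη)
  choose St hSt using stage
  let rs : ℕ → List T2 := fun n => Nat.rec [] (fun _ r => r ++ [St r]) n
  have hrs : ∀ n, rs (n+1) = rs n ++ [St (rs n)] := fun n => rfl
  let v : ℕ → T2 := fun n => St (rs n)
  have hrv : ∀ n, rs n = (List.range n).map v := by
    intro n
    induction n with
    | zero => rfl
    | succ n ih => 
      rw [hrs, List.range_succ, List.map_append, ← ih]; rfl
  have hrl : ∀ n, (rs n).length = n := by intro n; rw [hrv]; simp
  have hv : ∀ n, _ := fun n => hSt (rs n)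
  simp only [hrl] at hv
  have hcofρ : ∀ n, ℵ₀ < (v n).2.cof := by
    intro n
    obtain ⟨-, -, a, b, -⟩ := hv n
    show ℵ₀ < (St (rs n)).2.cof
    by_cases hb : bit e (rs n) (St (rs n)).1
    · rw [a hb]; exact aleph0_lt_aleph_one
    · rw [b hb, ← aleph_zero, aleph_lt_aleph]; exact two_pos
  have hη : ∀ n, ∃ η < (v n).2, ∀ y ∈ range (xv e v), y < (v n).2 → y < η := fun n =>
    bound_ctbl _ (hcofρ n) _ (countable_range _)
  choose η hη1 hη2 using hη
  let u : ℕ → T3 := fun n => ((v n).1, η n, (v n).2)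
  have hpu : proj ∘ u = v := rfl
  have hηL : ∀ n, η n < (κ n).ord := fun n => (hη1 n).trans (hv n).2.1
  have hz : ∀ n, ∃ h : List (Iio (Kc κ (rs n).length).ord), h.length = n ∧
      zipp (rs n) (h.map Subtype.val) = (List.range n).map u := by
    intro n
    have hmem : ∀ y ∈ (List.range n).map η, y ∈ Iio (Kc κ (rs n).length).ord := by
      intro y hy
      obtain ⟨j, hj, rfl⟩ := List.mem_map.1 hy
      rw [hrl]
      exact (hηL j).trans_le (Cardinal.ord_le_ord.2 (le_Kc κ hmono (List.mem_range.1 hj)))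
    have e1 := zipp_range v η n
    rw [← hrv] at e1
    have e2 : ((List.range n).map η).length = n := by simp
    generalize (List.range n).map η = H at *
    lift H to List (Iio (Kc κ (rs n).length).ord) using hmem
    refine ⟨H, by simpa using e2, ?_⟩
    exact e1
  obtain ⟨n, hn⟩ := h3 u (by
    intro n
    obtain ⟨h, hh, hzz⟩ := hz n
    obtain ⟨⟨a1, a2⟩, a3, a4, a5, a6⟩ := hv n
    have a2' := a2 h
    have a6' := a6 h hh (η n) (hη1 n)
    rw [hzz] at a2' a6'
    have hmp : ((List.range n).map u).map proj = rs n := by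
      rw [hrv, List.map_map, hpu]
    refine ⟨a2', a1, ?_, a6', ?_, ?_⟩
    · simpa using hηL n
    · simpa using a3
    · unfold Col
      rw [hmp]
      exact ⟨a4, a5⟩)
  apply hn
  rw [legal_range]
  intro i _ m _ hx
  exact hη2 m _ (mem_range_self i) hx



def PickOK (μ lam : Cardinal.{0}) (κ : ℕ → Cardinal.{0}) (f : Ordinal.{0} → ℕ → Ordinal.{0})
    (X : List T2 → ℕ → Ordinal.{0}) (H : List T2 → Ordinal.{0} → Ordinal.{0})
    (P : Set Ordinal.{0}) (θ : Ordinal.{0}) (m : ℕ) : Prop :=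
  θ < lam.ord ∧ (∀ y ∈ P, y < θ) ∧
  (∀ l : List T2, (∀ p ∈ l, p.1 ∈ P ∧ p.2 < μ.ord) → ∀ i, X l i < lam.ord → X l i < θ) ∧
  ∀ n ≥ m, ∀ l : List T2, (∀ p ∈ l, p.1 ∈ P ∧ p.2 < (Kc κ n).ord) → ∀ α ∈ P,
    H l α < (κ n).ord → H l α < f θ n

theorem card_lists (P : Set Ordinal.{0}) (hP : P.Countable) (c κ : Cardinal.{0})
    (hκ : ℵ₀ < κ) (hc : c < κ) : #(List (P ×ˢ Iio c.ord : Set T2)) < Cardinal.lift.{1,0} κ := by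
  apply card_list_lt _ hκ
  rw [Cardinal.mk_setProd]
  have hκ' : ℵ₀ < Cardinal.lift.{1,0} κ := by simpa using hκ
  exact Cardinal.mul_lt_of_lt hκ'.le ((Cardinal.mk_le_aleph0_iff.2 hP).trans_lt hκ')
    (mk_Iio_ord_lt hc)

theorem pick (μ lam : Cardinal.{0}) (κ : ℕ → Cardinal.{0}) (f : Ordinal.{0} → ℕ → Ordinal.{0})
    (hμ : ℵ₀ ≤ μ) (hlam : lam = Order.succ μ) (hκ : ∀ n, (κ n).IsRegular)
    (hbig : ∀ n, aleph 2 < κ n) (hmono : StrictMono κ) (hf : TcfWitness lam κ f)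
    (X : List T2 → ℕ → Ordinal.{0}) (H : List T2 → Ordinal.{0} → Ordinal.{0})
    (P : Set Ordinal.{0}) (hP : P.Countable) (hPΛ : P ⊆ Iio lam.ord) :
    ∃ θ m, PickOK μ lam κ f X H P θ m := by
  have hμl : μ < lam := by rw [hlam]; exact Order.lt_succ μ
  have hlreg : lam.IsRegular := by rw [hlam]; exact isRegular_succ hμ
  have hlim := Cardinal.isSuccLimit_ord hlreg.aleph0_le
  have hκ0 : ∀ n, ℵ₀ < κ n := fun n => (Cardinal.aleph0_le_aleph 2).trans_lt (hbig n)
  have hl0 : ℵ₀ < lam := hμ.trans_lt hμl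
  have hcl : ∀ {c κ : Cardinal.{0}} (_ : ℵ₀ < κ) (_ : c < κ),
      #(List (P ×ˢ Iio c.ord : Set T2)) < Cardinal.lift.{1,0} κ := fun h1 h2 =>
    card_lists P hP _ _ h1 h2
  have hctb : ∀ {κ : Cardinal.{0}}, ℵ₀ < κ → #P < Cardinal.lift.{1,0} κ := by
    intro κ h
    have h' : ℵ₀ < Cardinal.lift.{1,0} κ := by simpa using h
    exact (Cardinal.mk_le_aleph0_iff.2 hP).trans_lt h'
  have hg : ∀ n, ∃ b < (κ n).ord, ∀ i : List (P ×ˢ Iio (Kc κ n).ord : Set T2) × P,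
      H (i.1.map Subtype.val) i.2 < (κ n).ord → H (i.1.map Subtype.val) i.2 < b := by
    intro n
    apply bound_reg (κ n) (hκ n) _ (fun i : List (P ×ˢ Iio (Kc κ n).ord : Set T2) × P =>
      H (i.1.map Subtype.val) i.2)
    rw [Cardinal.mk_prod, Cardinal.lift_id, Cardinal.lift_id]
    exact Cardinal.mul_lt_of_lt (by simpa using (hκ n).aleph0_le)
      (hcl (hκ0 n) (Kc_lt κ hmono (fun n => (hκ n).pos) n)) (hctb (hκ0 n))
  choose g hg1 hg2 using hg
  obtain ⟨α0, hα0, m1, hm1⟩ := hf.2.2 g hg1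
  obtain ⟨b1, hb1, hb1'⟩ := bound_reg lam hlreg (hctb hl0) (fun y => y.1)
  obtain ⟨b2, hb2, hb2'⟩ := bound_reg (ι := List (P ×ˢ Iio μ.ord : Set T2) × ℕ) lam hlreg (by
    rw [Cardinal.mk_prod]
    refine Cardinal.mul_lt_of_lt (by simpa using hl0.le) (by simpa using hcl hl0 hμl) ?_
    simpa using hl0) (fun i => X (i.1.map Subtype.val) i.2)
  have hθ : max (max b1 b2) (Order.succ α0) < lam.ord := max_lt (max_lt hb1 hb2) (hlim.succ_lt hα0)
  obtain ⟨m2, hm2⟩ := hf.2.1 α0 hα0 _ hθ (lt_max_of_lt_right (Order.lt_succ _))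
  refine ⟨max (max b1 b2) (Order.succ α0), max m1 m2, hθ, ?_, ?_, ?_⟩
  · intro y hy
    exact lt_max_of_lt_left (lt_max_of_lt_left (hb1' ⟨y, hy⟩ (hPΛ hy)))
  · intro l hl i hX
    replace hl : ∀ p ∈ l, p ∈ (P ×ˢ Iio μ.ord : Set T2) := hl
    lift l to List (P ×ˢ Iio μ.ord : Set T2) using hl
    exact lt_max_of_lt_left (lt_max_of_lt_right (hb2' (l, i) hX))
  · intro n hn l hl α hα hH
    replace hl : ∀ p ∈ l, p ∈ (P ×ˢ Iio (Kc κ n).ord : Set T2) := hl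
    lift l to List (P ×ˢ Iio (Kc κ n).ord : Set T2) using hl
    exact (hg2 n (l, ⟨α, hα⟩) hH).trans ((hm1 n (le_trans (le_max_left _ _) hn)).trans
      (hm2 n (le_trans (le_max_right _ _) hn)))

theorem mk_Iio_omega1 : #(Iio (aleph 1 : Cardinal.{0}).ord) = Cardinal.lift.{1,0} (aleph 1) := by
  rw [Cardinal.mk_Iio_ordinal]; simp

theorem countable_Iio_of_lt {i : Ordinal.{0}} (h : i < (aleph 1).ord) : (Iio i).Countable := by
  have h2 : #(Iio i) < aleph 1 := by
    rw [Cardinal.mk_Iio_ordinal, Cardinal.lift_lt_aleph_one]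
    exact Cardinal.lt_ord.1 h
  exact (Cardinal.countable_iff_lt_aleph_one _).2 h2

theorem not_countable_Iio_omega1 : ¬ (Iio (aleph 1 : Cardinal.{0}).ord).Countable := by
  intro h
  have := (Cardinal.countable_iff_lt_aleph_one _).1 h
  rw [mk_Iio_omega1] at this
  simp at this

/-- the thread of ordinals -/
theorem thread (μ lam : Cardinal.{0}) (κ : ℕ → Cardinal.{0}) (f : Ordinal.{0} → ℕ → Ordinal.{0})
    (hμ : ℵ₀ ≤ μ) (hlam : lam = Order.succ μ) (hκ : ∀ n, (κ n).IsRegular)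
    (hbig : ∀ n, aleph 2 < κ n) (hmono : StrictMono κ) (hf : TcfWitness lam κ f)
    (hfree : ∀ I : Set Ordinal.{0}, I ⊆ Set.Iio lam.ord →
      #I ≤ Cardinal.lift.{1,0} (aleph 1) → Free I f)
    (X : List T2 → ℕ → Ordinal.{0}) (H : List T2 → Ordinal.{0} → Ordinal.{0}) :
    ∃ (t : ℕ → Ordinal.{0}) (δ : Ordinal.{0}) (k : ℕ) (P : ℕ → Set Ordinal.{0}),
      δ < lam.ord ∧ (∀ n, t n < lam.ord) ∧ (∀ n, t n < t (n+1)) ∧ (∀ n, t n < δ) ∧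
      (∀ y < δ, ∃ n, y < t n) ∧
      (∀ n, ∀ j < n, t j ∈ P n) ∧
      (∀ n, PickOK μ lam κ f X H (P n) (t n) k) ∧ ∀ j, ∀ n ≥ k, f (t j) n < f δ n := by
  classical
  have hpk : ∀ P : Set Ordinal.{0}, ∃ θ m, P.Countable → P ⊆ Iio lam.ord →
      PickOK μ lam κ f X H P θ m := by
    intro P
    by_cases h : P.Countable ∧ P ⊆ Iio lam.ord
    · obtain ⟨θ, m, hh⟩ := pick μ lam κ f hμ hlam hκ hbig hmono hf X H P h.1 h.2
      exact ⟨θ, m, fun _ _ => hh⟩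
    · exact ⟨0, 0, fun h1 h2 => absurd ⟨h1, h2⟩ h⟩
  choose pk pm hpk using hpk
  let F : (i : Ordinal.{0}) → ((j : Ordinal.{0}) → j < i → Ordinal.{0}) → Ordinal.{0} := fun i r =>
    pk {y | ∃ j, ∃ h : j < i, r j h = y}
  let θ : Ordinal.{0} → Ordinal.{0} := WellFounded.fix (r := (· < ·)) Ordinal.lt_wf F
  have hθ : ∀ i, θ i = pk (θ '' Iio i) := by
    intro i
    have h1 : θ i = F i (fun j _ => θ j) := WellFounded.fix_eq _ F i
    rw [h1]
    show pk _ = pk _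
    congr 1
    ext y
    constructor
    · rintro ⟨j, h, rfl⟩; exact ⟨j, h, rfl⟩
    · rintro ⟨j, h, rfl⟩; exact ⟨j, h, rfl⟩
  have hok : ∀ i < (aleph 1).ord, PickOK μ lam κ f X H (θ '' Iio i) (θ i) (pm (θ '' Iio i)) := by
    intro i
    induction i using WellFoundedLT.induction with
    | ind i ih =>
      intro hi
      rw [hθ i]
      apply hpk
      · exact (countable_Iio_of_lt hi).image θ
      · rintro _ ⟨j, hj, rfl⟩
        exact (ih j hj (lt_trans hj hi)).1
  have hmonoθ : ∀ i < (aleph 1).ord, ∀ j < i, θ j < θ i := fun i hi j hj =>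
    (hok i hi).2.1 _ ⟨j, hj, rfl⟩
  let D : Ordinal.{0} → Ordinal.{0} := fun i => sSup (θ '' Iio i)
  have hDle : ∀ i < (aleph 1).ord, D i ≤ θ i := by
    intro i hi
    apply csSup_le'
    rintro _ ⟨j, hj, rfl⟩
    exact (hmonoθ i hi j hj).le
  obtain ⟨nf, hnf⟩ := hfree (θ '' Iio (aleph 1).ord ∪ D '' Iio (aleph 1).ord) (by
    rintro _ (⟨i, hi, rfl⟩ | ⟨i, hi, rfl⟩)
    · exact (hok i hi).1
    · exact (hDle i hi).trans_lt (hok i hi).1) (by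
    refine (Cardinal.mk_union_le _ _).trans ?_
    have h1 : ∀ g : Ordinal.{0} → Ordinal.{0}, #(g '' Iio (aleph 1).ord) ≤ Cardinal.lift.{1,0} (aleph 1) :=
      fun g => Cardinal.mk_image_le.trans mk_Iio_omega1.le
    refine Cardinal.add_le_of_le ?_ (h1 _) (h1 _)
    simp)
  let kk : Ordinal.{0} → ℕ := fun i => max (pm (θ '' Iio i)) (nf (θ i))
  have hZ : ∃ k, ¬ {i ∈ Iio (aleph 1).ord | kk i = k}.Countable := by
    by_contra hcon
    push Not at hcon
    apply not_countable_Iio_omega1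
    refine (countable_iUnion hcon).mono ?_
    intro i hi
    exact mem_iUnion.2 ⟨kk i, hi, rfl⟩
  obtain ⟨k, hk⟩ := hZ
  set Z := {i ∈ Iio (aleph 1).ord | kk i = k} with hZdef
  have hΩlim := Cardinal.isSuccLimit_ord (Cardinal.aleph0_le_aleph 1)
  have hnext : ∀ i : Ordinal.{0}, ∃ z, i < (aleph 1).ord → z ∈ Z ∧ i < z := by
    intro i
    by_cases hi : i < (aleph 1).ord
    · by_contra hcon
      push Not at hcon
      apply hk
      refine (countable_Iio_of_lt (hΩlim.succ_lt hi)).mono ?_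
      intro z hz
      exact Order.lt_succ_iff.2 ((hcon z).2 hz)
    · exact ⟨0, fun h => absurd h hi⟩
  choose nxt hnxt using hnext
  let ii : ℕ → Ordinal.{0} := fun n => nxt^[n+1] 0
  have hii1 : ∀ n, ii (n+1) = nxt (ii n) := fun n => Function.iterate_succ_apply' nxt (n+1) 0
  have hΩpos : 0 < (aleph 1).ord := hΩlim.bot_lt
  have hiiZ : ∀ n, ii n ∈ Z := by
    intro n
    induction n with
    | zero => exact (hnxt 0 hΩpos).1
    | succ n ih => rw [hii1]; exact (hnxt _ ih.1).1
  have hiilt : ∀ n, ii n < ii (n+1) := by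
    intro n; rw [hii1]; exact (hnxt _ (hiiZ n).1).2
  have hiim : StrictMono ii := strictMono_nat_of_lt_succ hiilt
  obtain ⟨b, hb, hb'⟩ := bound_ctbl (aleph 1).ord (by
    rw [isRegular_aleph_one.cof_ord]; exact aleph0_lt_aleph_one) (range ii) (countable_range ii)
  have hbdd : BddAbove (range ii) := bddAbove_ctbl (countable_range ii)
  let s := sSup (range ii)
  have hs : s < (aleph 1).ord := by
    refine lt_of_le_of_lt (csSup_le' ?_) hb
    rintro _ ⟨n, rfl⟩
    exact (hb' _ ⟨n, rfl⟩ (hiiZ n).1).le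
  have hiis : ∀ n, ii n < s := fun n => (hiilt n).trans_le (le_csSup hbdd ⟨n+1, rfl⟩)
  have hbddD : BddAbove (θ '' Iio s) := bddAbove_ctbl ((countable_Iio_of_lt hs).image θ)
  have htδ : ∀ n, θ (ii n) < D s := fun n =>
    (hmonoθ _ (hiiZ (n+1)).1 _ (hiilt n)).trans_le (le_csSup hbddD ⟨_, hiis (n+1), rfl⟩)
  refine ⟨fun n => θ (ii n), D s, max k (nf (D s)), fun n => θ '' Iio (ii n),
    (hDle s hs).trans_lt (hok s hs).1, fun n => (hok _ (hiiZ n).1).1,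
    fun n => hmonoθ _ (hiiZ (n+1)).1 _ (hiilt n), htδ, ?_, ?_, ?_, ?_⟩
  · intro y hy
    obtain ⟨_, ⟨j, hj, rfl⟩, hyj⟩ := exists_lt_of_lt_csSup' hy
    obtain ⟨_, ⟨n, rfl⟩, hn⟩ := exists_lt_of_lt_csSup' (show j < s from hj)
    exact ⟨n, hyj.trans (hmonoθ _ (hiiZ n).1 _ hn)⟩
  · intro n j hj
    exact ⟨ii j, hiim hj, rfl⟩
  · intro n
    obtain ⟨a1, a2, a3, a4⟩ := hok _ (hiiZ n).1
    refine ⟨a1, a2, a3, fun m hm => a4 m ?_⟩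
    exact (le_max_left _ _).trans ((hiiZ n).2.le.trans ((le_max_left _ _).trans hm))
  · intro j n hn
    refine hnf _ (Or.inl ⟨ii j, (hiiZ j).1, rfl⟩) _ (Or.inr ⟨s, hs, rfl⟩) (htδ j) n ?_ ?_
    · exact (le_max_right _ _).trans ((hiiZ j).2.le.trans ((le_max_left _ _).trans hn))
    · exact (le_max_right _ _).trans hn



theorem xv_ext (e) (u : ℕ → T3) (n i : ℕ) (hi : i < n) :
    xv e (ext (((List.range n).map u).map proj)) i = xv e (proj ∘ u) i := by
  have h1 : ∀ j < n, ext (((List.range n).map u).map proj) j = (proj ∘ u) j := by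
    intro j hj
    simp [ext, List.getD_eq_getElem?_getD, hj]
  apply xv_congr
  · intro j hj; exact h1 j (by omega)
  · rw [h1 i hi]

def GoodSet (f : Ordinal.{0} → ℕ → Ordinal.{0}) (a : Set Ordinal.{0}) : Prop :=
  (∀ y ∈ a, ∃ z ∈ a, y < z) ∧ 
  ∃ x ρ : ℕ → Ordinal.{0}, ∃ m : ℕ, range x = a ∧ ∀ n ≥ m,
      IsLeast {y ∈ a | f (sSup a) n ≤ y} (ρ n) ∧
        ((ρ n).cof = aleph 1 ↔ x n.unpair.1 < x n.unpair.2)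

theorem stat (μ lam : Cardinal.{0}) (κ : ℕ → Cardinal.{0}) (f : Ordinal.{0} → ℕ → Ordinal.{0})
    (hμ : ℵ₀ ≤ μ) (hlam : lam = Order.succ μ) (hκ : ∀ n, (κ n).IsRegular)
    (hbig : ∀ n, aleph 2 < κ n) (hmono : StrictMono κ) (hκμ : ∀ n, κ n ≤ μ)
    (hf : TcfWitness lam κ f)
    (hfree : ∀ I : Set Ordinal.{0}, I ⊆ Set.Iio lam.ord →
      #I ≤ Cardinal.lift.{1,0} (aleph 1) → Free I f)
    (C : Set (Set Ordinal.{0})) (hC : ClubFam (Iio lam.ord) C) :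
    ∃ N ∈ C, N ∈ ctblInf (Iio lam.ord) ∧ GoodSet f N := by
  have hμl : μ < lam := by rw [hlam]; exact Order.lt_succ μ
  have hlreg : lam.IsRegular := by rw [hlam]; exact isRegular_succ hμ
  have hlim := Cardinal.isSuccLimit_ord hlreg.aleph0_le
  have hΛ : 0 < lam.ord := hlim.bot_lt
  obtain ⟨e, he, hcl⟩ := club_fn lam.ord hΛ C hC
  set L : ℕ → Ordinal.{0} := fun n => (κ n).ord with hL
  have hLpos : ∀ n, 0 < L n := fun n => (Cardinal.isSuccLimit_ord (hκ n).aleph0_le).bot_lt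
  have hLΛ : ∀ n, L n < lam.ord := fun n => Cardinal.ord_lt_ord.2 ((hκμ n).trans_lt hμl)
  have hnil : ¬ Lose e L lam.ord [] :=
    not_lose_nil κ lam hκ hbig hmono hlreg (fun n => (hκμ n).trans_lt hμl) e
  have hstep : ∀ (s : List T3) (α : Ordinal.{0}), ∃ (q η : Ordinal.{0}) (R : Ordinal.{0} → Ordinal.{0}),
      ¬ Lose e L lam.ord s → α < lam.ord → α < q ∧ q < lam.ord ∧ η < L s.length ∧
      ∀ ξ < L s.length, ξ < R ξ ∧ R ξ < L s.length ∧ Col e s q (R ξ) ∧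
        ¬ Lose e L lam.ord (s ++ [(q, η, R ξ)]) := by
    intro s α
    by_cases h : ¬ Lose e L lam.ord s ∧ α < lam.ord
    · obtain ⟨q, η, h1, h2, h3, h4⟩ := not_lose_step e L lam.ord s h.1 (hLpos _) α h.2
      choose! R hR using h4
      exact ⟨q, η, R, fun _ _ => ⟨h1, h2, h3, hR⟩⟩
    · exact ⟨0, 0, id, fun h1 h2 => absurd ⟨h1, h2⟩ h⟩
  choose Qf Hf Rf hQ using hstep
  let mv : List T3 → T2 → T3 := fun s p => (Qf s p.1, Hf s p.1, Rf s p.1 p.2)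
  let pos : List T2 → List T3 := fun l => l.foldl (fun s p => s ++ [mv s p]) []
  have hpos : ∀ l p, pos (l ++ [p]) = pos l ++ [mv (pos l) p] := by
    intro l p
    simp [pos, List.foldl_append]
  obtain ⟨t, δ, k, P, hδ, htΛ, htlt, htδ, hcofin, htP, hpick, hfδ⟩ :=
    thread μ lam κ f hμ hlam hκ hbig hmono hf hfree
      (fun l i => xv e (ext ((pos l).map proj)) i) (fun l α => Hf (pos l) α)
  let w : ℕ → T2 := fun n => (t n, f δ n)
  let l : ℕ → List T2 := fun n => (List.range n).map w
  have hl : ∀ n, l (n+1) = l n ++ [w n] := by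
    intro n; simp [l, List.range_succ]
  let u : ℕ → T3 := fun n => mv (pos (l n)) (w n)
  have hs : ∀ n, pos (l n) = (List.range n).map u := by
    intro n
    induction n with
    | zero => rfl
    | succ n ih =>
      rw [hl, hpos, List.range_succ, List.map_append, ← ih]; rfl
  have hlen : ∀ n, (pos (l n)).length = n := by intro n; rw [hs]; simp
  have hfL : ∀ n, f δ n < L n := fun n => hf.1 δ hδ n
  have hnl : ∀ n, ¬ Lose e L lam.ord (pos (l n)) := by
    intro n
    induction n with
    | zero => exact hnil
    | succ n ih =>
      rw [hl, hpos]
      exact ((hQ _ (t n) ih (htΛ n)).2.2.2 (f δ n) (by rw [hlen]; exact hfL n)).2.2.2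
  have hmv : ∀ n, t n < (u n).1 ∧ (u n).1 < lam.ord ∧ (u n).2.1 < L n ∧ f δ n < (u n).2.2 ∧
      (u n).2.2 < L n ∧ Col e (pos (l n)) (u n).1 (u n).2.2 := by
    intro n
    obtain ⟨a1, a2, a3, a4⟩ := hQ _ (t n) (hnl n) (htΛ n)
    obtain ⟨b1, b2, b3, b4⟩ := a4 (f δ n) (by rw [hlen]; exact hfL n)
    rw [hlen] at a3 b2
    exact ⟨a1, a2, a3, b1, b2, b3⟩
  let v : ℕ → T2 := proj ∘ u
  let x : ℕ → Ordinal.{0} := xv e v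
  have hx0 : ∀ j, x (Nat.pair 0 j) = (u j).1 := fun j => xv_pair_zero e v j
  have hx1 : ∀ j, x (Nat.pair 1 j) = (u j).2.2 := fun j => xv_pair_one e v j
  have hx2 : ∀ i j, x (Nat.pair (i+2) j) = e (hist x i) j := fun i j => xv_pair_two e v i j
  have hxΛ : ∀ n, x n < lam.ord := by
    intro n
    obtain ⟨i, j, rfl⟩ : ∃ i j, n = Nat.pair i j := ⟨n.unpair.1, n.unpair.2, (Nat.pair_unpair n).symm⟩
    rcases i with _ | _ | i
    · rw [hx0]; exact (hmv j).2.1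
    · rw [hx1]; exact (hmv j).2.2.2.2.1.trans (hLΛ j)
    · rw [hx2]; exact he _ _
  have hlmem : ∀ n, ∀ p ∈ l n, ∃ j < n, p = w j := by
    intro n p hp
    obtain ⟨j, hj, rfl⟩ := List.mem_map.1 hp
    exact ⟨j, List.mem_range.1 hj, rfl⟩
  have hxt : ∀ n, x n < t (n+1) := by
    intro n
    have h1 := (hpick (n+1)).2.2.1 (l (n+1)) (by
      intro p hp
      obtain ⟨j, hj, rfl⟩ := hlmem _ p hp
      exact ⟨htP _ j hj, (hfL j).trans_le (Cardinal.ord_le_ord.2 (hκμ j))⟩) n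
    have h2 : xv e (ext ((pos (l (n+1))).map proj)) n = x n := by
      rw [hs, xv_ext e u (n+1) n (Nat.lt_succ_self n)]
    beta_reduce at h1
    rw [h2] at h1
    exact h1 (hxΛ n)
  have hη : ∀ n ≥ k, (u n).2.1 < f δ n := by
    intro n hn
    refine lt_trans ?_ (hfδ (n+1) n hn)
    refine (hpick (n+1)).2.2.2 n hn (l n) ?_ (t n) (htP _ n (Nat.lt_succ_self n)) (hmv n).2.2.1
    intro p hp
    obtain ⟨j, hj, rfl⟩ := hlmem _ p hp
    exact ⟨htP _ j (by omega), (hfL j).trans_le (Cardinal.ord_le_ord.2 (le_Kc κ hmono hj))⟩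
  have hlegal : ∀ i m, x i < (u m).2.2 → x i < (u m).2.1 := by
    intro i m
    have h1 : Legal e (pos (l (i + m + 1))) := by
      by_contra h
      exact hnl _ (Lose.ill _ h)
    rw [hs, legal_range] at h1
    exact h1 i (by omega) m (by omega)
  have hne : (range x).Nonempty := range_nonempty x
  have hnomax : ∀ y ∈ range x, ∃ z ∈ range x, y < z := by
    rintro _ ⟨n, rfl⟩
    exact ⟨x (Nat.pair 0 (n+1)), mem_range_self _, (hxt n).trans (by rw [hx0]; exact (hmv (n+1)).1)⟩
  have hsup : sSup (range x) = δ := by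
    apply le_antisymm
    · apply csSup_le'
      rintro _ ⟨n, rfl⟩
      exact ((hxt n).trans (htδ _)).le
    · by_contra hlt
      push Not at hlt
      obtain ⟨n, hn⟩ := hcofin _ hlt
      have h2 : x (Nat.pair 0 n) ≤ sSup (range x) :=
        le_csSup (bddAbove_ctbl (countable_range x)) (mem_range_self _)
      rw [hx0] at h2
      exact absurd (hn.trans (hmv n).1) (not_lt.2 h2)
  refine ⟨range x, hcl x hxΛ (fun m j => ⟨Nat.pair (m+2) j, hx2 m j⟩), ⟨?_, countable_range x, ?_⟩,
    hnomax, x, fun n => (u n).2.2, k, rfl, ?_⟩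
  · rintro _ ⟨n, rfl⟩; exact hxΛ n
  · intro hfin
    obtain ⟨y, hy, hmax⟩ := hfin.exists_maximal hne
    obtain ⟨z, hz, hyz⟩ := hnomax y hy
    exact absurd (hmax hz hyz.le) (not_le.2 hyz)
  · intro n hn
    rw [hsup]
    refine ⟨⟨⟨⟨Nat.pair 1 n, hx1 n⟩, (hmv n).2.2.2.1.le⟩, ?_⟩, ?_⟩
    · rintro _ ⟨⟨i, rfl⟩, hi⟩
      by_contra hlt
      push Not at hlt
      exact absurd ((hlegal i n hlt).trans (hη n hn)) (not_lt.2 hi)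
    · obtain ⟨c1, c2⟩ := (hmv n).2.2.2.2.2
      have hb : bit e ((pos (l n)).map proj) (u n).1 ↔ x n.unpair.1 < x n.unpair.2 := by
        rw [hs, List.map_map]
        exact bit_iff e v n
      rw [← hb]
      constructor
      · intro h
        by_contra h2
        have := c2 h2
        simp only at h
        rw [h] at this
        have h3 := aleph_lt_aleph.2 (one_lt_two (α := Ordinal.{0}))
        exact absurd this h3.ne
      · exact c1

theorem main (μ μs lam : Cardinal.{0}) (κ : ℕ → Cardinal.{0}) (f : Ordinal.{0} → ℕ → Ordinal.{0})
    (hμ : ℵ₀ ≤ μ) (hlam : lam = Order.succ μ) (hμs1 : Cardinal.aleph 2 ≤ μs)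
    (hκ : ∀ n, (κ n).IsRegular)
    (hbig : ∀ n, aleph 2 < κ n) (hmono : StrictMono κ) (hκμ : ∀ n, κ n ≤ μ)
    (hf : TcfWitness lam κ f)
    (hfree : ∀ I : Set Ordinal.{0}, I ⊆ Set.Iio lam.ord →
      #I < Cardinal.lift.{1,0} μs → Free I f) :
    ∃ 𝒜 : Set (Set Ordinal.{0}), 𝒜 ⊆ ctblInf (Set.Iio lam.ord) ∧
      StatFam (Set.Iio lam.ord) 𝒜 ∧
      ∀ A : Set Ordinal.{0}, A ⊆ Set.Iio lam.ord → ¬ A.Countable →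
        #A < Cardinal.lift.{1,0} μs → ¬ Reflects 𝒜 A := by
  have h12 : (aleph 1 : Cardinal.{0}) < aleph 2 := aleph_lt_aleph.2 (one_lt_two (α := Ordinal.{0}))
  have hlreg : lam.IsRegular := by rw [hlam]; exact isRegular_succ hμ
  have hfree1 : ∀ I : Set Ordinal.{0}, I ⊆ Set.Iio lam.ord →
      #I ≤ Cardinal.lift.{1,0} (aleph 1) → Free I f := fun I hI hc =>
    hfree I hI (hc.trans_lt (Cardinal.lift_lt.2 (h12.trans_le hμs1)))
  refine ⟨{a | a ∈ ctblInf (Iio lam.ord) ∧ GoodSet f a}, fun a ha => ha.1,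
    ⟨fun a ha => ⟨ha.1.1, ha.1.2.1⟩, ?_⟩, ?_⟩
  · intro C hC
    obtain ⟨N, h1, h2, h3⟩ := stat μ lam κ f hμ hlam hκ hbig hmono hκμ hf hfree1 C hC
    exact ⟨N, ⟨h2, h3⟩, h1⟩
  · intro A hA hAc hAcard hrefl
    refine nonrefl A hAc _ inter_subset_right (meetsF_of_meetsClubs hrefl.2) f ?_
      (fun o => o.cof = aleph 1) (fun a ha => ha.1.2.2)
    apply hfree
    · rintro _ ⟨a, ha, rfl⟩
      have h0 : ℵ₀ < lam.ord.cof := by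
        rw [hlreg.cof_ord, hlam]; exact hμ.trans_lt (Order.lt_succ μ)
      obtain ⟨b, hb, hb'⟩ := bound_ctbl lam.ord h0 a ha.1.1.2.1
      exact lt_of_le_of_lt (csSup_le' fun y hy => (hb' y hy (ha.1.1.1 hy)).le) hb
    · exact card_sups A _ inter_subset_right (fun a ha => ha.1.2.1) μs
        ((Cardinal.aleph0_le_aleph 2).trans hμs1) hAcard


/-- if `μ` is singular of cofinality `ℵ₀`, `λ = μ⁺`,
`ℵ₂ ≤ μ* ≤ λ`, `⟨λ_n⟩` is a strictly increasing sequence of regular cardinals `> ℵ₁`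
with supremum `μ`, and `⟨f_α : α < λ⟩` witnesses `λ = tcf(∏ λ_n, <_{J^bd_ω})` and is
`μ*`-free, then some stationary `𝒜 ⊆ [λ]^{ℵ₀}` does not reflect in any uncountable
`A ⊆ λ` of cardinality `< μ*`. -/
theorem stmt0 (μ μs lam : Cardinal.{0}) (lamseq : ℕ → Cardinal.{0})
    (f : Ordinal.{0} → ℕ → Ordinal.{0})
    (hμ : ℵ₀ < μ) (hcf : μ.ord.cof = ℵ₀)
    (hlam : lam = Order.succ μ)
    (hμs1 : Cardinal.aleph 2 ≤ μs) (hμs2 : μs ≤ lam)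
    (hreg : ∀ n : ℕ, (lamseq n).IsRegular)
    (hbig : ∀ n : ℕ, Cardinal.aleph 1 < lamseq n)
    (hmono : StrictMono lamseq)
    (hsup : ⨆ n : ℕ, lamseq n = μ)
    (hf : TcfWitness lam lamseq f)
    (hfree : ∀ I : Set Ordinal.{0}, I ⊆ Set.Iio lam.ord →
      #I < Cardinal.lift.{1,0} μs → Free I f) :
    ∃ 𝒜 : Set (Set Ordinal.{0}), 𝒜 ⊆ ctblInf (Set.Iio lam.ord) ∧
      StatFam (Set.Iio lam.ord) 𝒜 ∧
      ∀ A : Set Ordinal.{0}, A ⊆ Set.Iio lam.ord → ¬ A.Countable →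
        #A < Cardinal.lift.{1,0} μs → ¬ Reflects 𝒜 A := by
  have h2 : (aleph 2 : Cardinal.{0}) = Order.succ (aleph 1) := by
    rw [← aleph_succ, Order.succ_eq_add_one, one_add_one_eq_two]
  refine main μ μs lam (fun n => lamseq (n+1)) (fun α n => f α (n+1)) hμ.le hlam hμs1
    (fun n => hreg _) ?_ ?_ ?_ ?_ ?_
  · intro n
    have h3 : aleph 2 ≤ lamseq 0 := by rw [h2]; exact Order.succ_le_of_lt (hbig 0)
    exact h3.trans_lt (hmono (Nat.succ_pos n))
  · intro a b hab
    exact hmono (Nat.succ_lt_succ hab)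
  · intro n
    rw [← hsup]
    exact le_ciSup (Cardinal.bddAbove_range lamseq) (n+1)
  · refine ⟨fun α hα n => hf.1 α hα (n+1), ?_, ?_⟩
    · intro α hα β hβ hlt
      obtain ⟨m, hm⟩ := hf.2.1 α hα β hβ hlt
      exact ⟨m, fun n hn => hm (n+1) (Nat.le_succ_of_le hn)⟩
    · intro g hg
      obtain ⟨α, hα, m, hm⟩ := hf.2.2 (fun n => match n with
        | 0 => 0
        | n+1 => g n) (by
          intro n
          match n with
          | 0 => exact (Cardinal.isSuccLimit_ord (hreg 0).aleph0_le).bot_lt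
          | n+1 => exact hg n)
      exact ⟨α, hα, m, fun n hn => hm (n+1) (Nat.le_succ_of_le hn)⟩
  · intro I hI hc
    obtain ⟨nf, hnf⟩ := hfree I hI hc
    exact ⟨nf, fun i hi j hj hij n h1 h2 => hnf i hi j hj hij (n+1) (Nat.le_succ_of_le h1)
      (Nat.le_succ_of_le h2)⟩

end ReflSCH
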